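/- Let M be a countable set, G ≤ Sym(M) a permutation group, and A ⊆ M a subset such that every orbit of the pointwise stabilizer G_{(A)} on M ∖ A is infinite. Let Ω = [0,1]^M carry the product σ-algebra and the shift action, and let μ be a G-invariant Borel probability measure on Ω. Then the σ-fields σ(ξ_a : a ∈ A) and σ(ξ_a : a ∈ M ∖ A) are conditionally independent, under μ, given the tail σ-field T₀. -/

import Mathlib

open MeasureTheory ProbabilityTheory

/-- The shift action of a permutation `g` of `M` on configurations `ω : M → [0,1]`:
`(g · ω)(a) = ω (g⁻¹ a)`. -/
def shiftAct {M : Type*} (g : Equiv.Perm M) (ω : M → unitInterval) : M → unitInterval :=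
  fun a => ω (g⁻¹ a)

/-- The σ-field generated by the coordinate projection `ξ_a`. -/
def coordField {M : Type*} (a : M) : MeasurableSpace (M → unitInterval) :=
  MeasurableSpace.comap (fun ω => ω a) inferInstance

/-- The tail σ-field `T₀ = ⋂ {σ(ξ_a : a ∉ A') : A' finite}`. -/
def tailField (M : Type*) : MeasurableSpace (M → unitInterval) :=
  ⨅ A : Finset M, ⨆ (a : M) (_ : a ∉ A), coordField a

lemma tailField_le (M : Type*) :
    tailField M ≤ (inferInstance : MeasurableSpace (M → unitInterval)) := by
  refine le_trans (iInf_le _ (∅ : Finset M)) ?_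
  exact iSup_le fun a => iSup_le fun _ => measurable_iff_comap_le.mp (measurable_pi_apply a)

open Filter Topology
open scoped Pointwise

section Neumann

/-- If all orbits of points outside `A` under the pointwise stabilizer of `A` are infinite, then
any finite set outside `A` can be moved off any given finite set by that stabilizer. -/
lemma exists_mem_stabilizer_disjoint {M : Type*} (G : Subgroup (Equiv.Perm M)) (A : Set M)
    (horb : ∀ b : M, b ∉ A → {c : M | ∃ g ∈ G, (∀ a ∈ A, g a = a) ∧ g b = c}.Infinite)
    (B S : Finset M) (hB : ∀ b ∈ B, b ∉ A) :
    ∃ g ∈ G, (∀ a ∈ A, g a = a) ∧ ∀ b ∈ B, g b ∉ S := by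
  classical
  let H : Subgroup (Equiv.Perm M) := G ⊓ fixingSubgroup (Equiv.Perm M) A
  have hH : ∀ g : Equiv.Perm M, g ∈ H ↔ g ∈ G ∧ ∀ a ∈ A, g a = a := fun g => by
    simp [H, Subgroup.mem_inf, mem_fixingSubgroup_iff]
  by_contra! hcon
  let I : Finset (M × M) := {p ∈ B ×ˢ S | ∃ g : H, (g : Equiv.Perm M) p.1 = p.2}
  have hI : ∀ p : I, ∃ g : H, (g : Equiv.Perm M) p.1.1 = p.1.2 := fun p =>
    (Finset.mem_filter.mp p.2).2
  choose r hr using hI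
  have hcover : ⋃ p ∈ (Finset.univ : Finset I),
      r p • ((MulAction.stabilizer H p.1.1 : Subgroup H) : Set H) = Set.univ := by
    refine Set.eq_univ_of_forall fun g => ?_
    obtain ⟨b, hb, hbS⟩ := hcon g ((hH _).mp g.2).1 ((hH _).mp g.2).2
    have hp : (b, (g : Equiv.Perm M) b) ∈ I :=
      Finset.mem_filter.mpr ⟨Finset.mem_product.mpr ⟨hb, hbS⟩, g, rfl⟩
    refine Set.mem_biUnion (Finset.mem_coe.mpr (Finset.mem_univ (⟨_, hp⟩ : I))) ?_
    rw [Set.mem_smul_set_iff_inv_smul_mem, SetLike.mem_coe, MulAction.mem_stabilizer_iff,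
      smul_eq_mul, mul_smul, inv_smul_eq_iff]
    exact (hr ⟨_, hp⟩).symm
  obtain ⟨p, -, hfin⟩ := Subgroup.exists_finiteIndex_of_leftCoset_cover hcover
  have hpB : p.1.1 ∈ B := (Finset.mem_product.mp (Finset.mem_filter.mp p.2).1).1
  refine horb p.1.1 (hB _ hpB) ?_
  have hfo : (MulAction.orbit H p.1.1).Finite := by
    have : Finite (H ⧸ MulAction.stabilizer H p.1.1) := Subgroup.finite_quotient_of_finiteIndex
    exact Set.finite_coe_iff.mp
      (Finite.of_equiv _ (MulAction.orbitEquivQuotientStabilizer H p.1.1).symm)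
  refine hfo.subset ?_
  rintro c ⟨g, hg, hgA, rfl⟩
  exact ⟨⟨g, (hH g).mpr ⟨hg, hgA⟩⟩, rfl⟩

end Neumann

section CondExp

variable {Ω : Type*} {m0 : MeasurableSpace Ω} {μ : Measure Ω}

lemma aestronglyMeasurable_iInf_of_antitone {G : ℕ → MeasurableSpace Ω} (hG : Antitone G)
    {f : Ω → ℝ} (hf : ∀ n, AEStronglyMeasurable[G n] f μ) :
    AEStronglyMeasurable[⨅ n, G n] f μ := by
  let g : ℕ → Ω → ℝ := fun n => (hf n).mk f
  have hg : ∀ n, Measurable[G n] (g n) := fun n => (hf n).stronglyMeasurable_mk.measurable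
  have hlim : ∀ k, Measurable[G k] (fun x => limsup (fun n => g n x) atTop) := fun k => by
    have h : (fun x => limsup (fun n => g n x) atTop)
        = fun x => limsup (fun n => g (n + k) x) atTop :=
      funext fun x => (limsup_nat_add (fun n => g n x) k).symm
    rw [h]
    let _ := G k
    exact Measurable.limsup fun n => (hg (n + k)).mono (hG (Nat.le_add_left k n)) le_rfl
  refine ⟨fun x => limsup (fun n => g n x) atTop, ?_, ?_⟩
  · let := ⨅ n, G n
    refine Measurable.stronglyMeasurable fun s hs => ?_
    exact MeasurableSpace.measurableSet_iInf.mpr fun k => hlim k hs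
  · have hae : ∀ᵐ x ∂μ, ∀ n, f x = g n x := ae_all_iff.mpr fun n => (hf n).ae_eq_mk
    filter_upwards [hae] with x hx
    simp [← hx]

/-- A weak form of Lévy's downward theorem. -/
lemma tendsto_setIntegral_condExp_iInf [IsFiniteMeasure μ] {G : ℕ → MeasurableSpace Ω}
    (hG : Antitone G) (hle : ∀ n, G n ≤ m0) {f : Ω → ℝ} (hf : MemLp f 2 μ)
    {u : Set Ω} (hu : MeasurableSet u) :
    Tendsto (fun n => ∫ x in u, (μ[f | G n]) x ∂μ) atTop
      (𝓝 (∫ x in u, (μ[f | ⨅ n, G n]) x ∂μ)) := by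
  have hinf : ⨅ n, G n ≤ m0 := (iInf_le _ 0).trans (hle 0)
  have : ∀ n, Fact (G n ≤ m0) := fun n => ⟨hle n⟩
  have : Fact (⨅ n, G n ≤ m0) := ⟨hinf⟩
  let K : ℕ → Submodule ℝ (Lp ℝ 2 μ) := fun n => lpMeas ℝ ℝ (G n) 2 μ
  let K' : Submodule ℝ (Lp ℝ 2 μ) := lpMeas ℝ ℝ (⨅ n, G n) 2 μ
  have : ∀ n, (K n).HasOrthogonalProjection := fun n => by
    dsimp only [K]; infer_instance
  have : K'.HasOrthogonalProjection := by dsimp only [K']; infer_instance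
  have hK' : (⨆ n, (K n)ᗮ)ᗮ = K' := by
    rw [← Submodule.iInf_orthogonal]
    ext y
    simp only [Submodule.orthogonal_orthogonal, Submodule.mem_iInf, K, K',
      mem_lpMeas_iff_aestronglyMeasurable]
    exact ⟨aestronglyMeasurable_iInf_of_antitone hG, fun h n => h.mono (iInf_le _ n)⟩
  have hcl : (⨆ n, (K n)ᗮ).topologicalClosure = K'ᗮ := by
    rw [← hK', Submodule.orthogonal_orthogonal_eq_closure]
  have : (⨆ n, (K n)ᗮ).topologicalClosure.HasOrthogonalProjection := by
    rw [hcl]; infer_instance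
  have hmono : Monotone fun n => (K n)ᗮ := fun i j hij => Submodule.orthogonal_le fun y hy => by
    simp only [K, mem_lpMeas_iff_aestronglyMeasurable] at hy ⊢
    exact hy.mono (hG hij)
  have ht := Submodule.starProjection_tendsto_closure_iSup (fun n => (K n)ᗮ) hmono (hf.toLp f)
  simp only [hcl, Submodule.starProjection_orthogonal_val] at ht
  have ht' : Tendsto (fun n => (K n).starProjection (hf.toLp f)) atTop
      (𝓝 (K'.starProjection (hf.toLp f))) := by
    simpa using (tendsto_const_nhds (x := hf.toLp f)).sub ht
  have hinner : ∀ (m : MeasurableSpace Ω) (hm : m ≤ m0),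
      inner ℝ (indicatorConstLp 2 hu (measure_ne_top μ u) (1 : ℝ))
        (condExpL2 ℝ ℝ hm (hf.toLp f) : Lp ℝ 2 μ) = ∫ x in u, (μ[f | m]) x ∂μ := fun m hm => by
    rw [L2.inner_indicatorConstLp_one]
    exact integral_congr_ae (ae_restrict_of_ae (hf.condExpL2_ae_eq_condExp hm))
  have := (tendsto_const_nhds
    (x := indicatorConstLp 2 hu (measure_ne_top μ u) (1 : ℝ))).inner (𝕜 := ℝ) ht'
  rw [← hinner _ hinf]
  simp_rw [← fun n => hinner _ (hle n)]
  exact this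

lemma memLp_two_indicator_one [IsFiniteMeasure μ] {s : Set Ω} (hs : MeasurableSet s) :
    MemLp (s.indicator fun _ => (1 : ℝ)) 2 μ :=
  memLp_indicator_const 2 hs 1 (Or.inr (measure_ne_top μ s))

lemma setIntegral_indicator_one_mul {s w : Set Ω} (hs : MeasurableSet s) (f : Ω → ℝ) :
    ∫ x in w, ((s.indicator fun _ => (1 : ℝ)) * f) x ∂μ = ∫ x in w ∩ s, f x ∂μ := by
  rw [← setIntegral_indicator hs]
  refine integral_congr_ae (Eventually.of_forall fun x => ?_)
  by_cases hx : x ∈ s <;> simp [hx]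

/-- Pythagoras' theorem for the conditional expectation as a projection. -/
lemma integral_sq_sub_eq_add [IsFiniteMeasure μ] {m : MeasurableSpace Ω} (hm : m ≤ m0)
    {f g : Ω → ℝ} (hf : MemLp f 2 μ) (hg : MemLp g 2 μ) (hgm : AEStronglyMeasurable[m] g μ) :
    ∫ x, (f x - g x) ^ 2 ∂μ
      = ∫ x, (f x - (μ[f | m]) x) ^ 2 ∂μ + ∫ x, ((μ[f | m]) x - g x) ^ 2 ∂μ := by
  have hc : MemLp (μ[f | m]) 2 μ := hf.condExp (by norm_num)
  have hfc : MemLp (f - μ[f | m]) 2 μ := hf.sub hc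
  have hcg : MemLp (μ[f | m] - g) 2 μ := hc.sub hg
  have hfi : Integrable f μ := hf.integrable (by norm_num)
  have hint : Integrable ((f - μ[f | m]) * (μ[f | m] - g)) μ := hfc.integrable_mul hcg
  have hzero : ∫ x, ((f - μ[f | m]) * (μ[f | m] - g)) x ∂μ = 0 := by
    rw [← integral_condExp hm]
    have h1 := condExp_mul_of_aestronglyMeasurable_right (m := m)
      (stronglyMeasurable_condExp.aestronglyMeasurable.sub hgm) hint
      (hfc.integrable (by norm_num))
    have h2 := condExp_sub hfi (integrable_condExp (m := m) (f := f) (μ := μ)) m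
    have h3 : μ[μ[f | m] | m] = μ[f | m] :=
      condExp_of_stronglyMeasurable hm stronglyMeasurable_condExp integrable_condExp
    rw [integral_eq_zero_of_ae]
    filter_upwards [h1, h2] with x hx1 hx2
    rw [hx1, Pi.mul_apply, hx2, h3]
    simp
  have hexp : ∀ x, (f x - g x) ^ 2 = (f x - (μ[f | m]) x) ^ 2 + ((μ[f | m]) x - g x) ^ 2
      + 2 * ((f - μ[f | m]) * (μ[f | m] - g)) x := fun x => by
    simp only [Pi.mul_apply, Pi.sub_apply]; ring
  have hi1 : Integrable (fun x => (f x - (μ[f | m]) x) ^ 2) μ := hfc.integrable_sq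
  have hi2 : Integrable (fun x => ((μ[f | m]) x - g x) ^ 2) μ := hcg.integrable_sq
  simp_rw [hexp]
  have hi12 : Integrable (fun x => (f x - (μ[f | m]) x) ^ 2 + ((μ[f | m]) x - g x) ^ 2) μ :=
    hi1.add hi2
  rw [integral_add hi12 (hint.const_mul 2), integral_add hi1 hi2, integral_const_mul,
    hzero, mul_zero, add_zero]

lemma integral_sq_sub_condExp_le [IsFiniteMeasure μ] {m : MeasurableSpace Ω} (hm : m ≤ m0)
    {f g : Ω → ℝ} (hf : MemLp f 2 μ) (hg : MemLp g 2 μ) (hgm : AEStronglyMeasurable[m] g μ) :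
    ∫ x, (f x - (μ[f | m]) x) ^ 2 ∂μ ≤ ∫ x, (f x - g x) ^ 2 ∂μ := by
  rw [integral_sq_sub_eq_add hm hf hg hgm]
  exact le_add_of_nonneg_right (integral_nonneg fun x => sq_nonneg _)

lemma condExp_ae_eq_of_integral_sq_sub_le [IsFiniteMeasure μ] {m k : MeasurableSpace Ω}
    (hm : m ≤ m0) (hkm : k ≤ m) {f : Ω → ℝ} (hf : MemLp f 2 μ)
    (hle : ∫ x, (f x - (μ[f | k]) x) ^ 2 ∂μ ≤ ∫ x, (f x - (μ[f | m]) x) ^ 2 ∂μ) :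
    μ[f | m] =ᵐ[μ] μ[f | k] := by
  have hk : MemLp (μ[f | k]) 2 μ := hf.condExp (by norm_num)
  have hc : MemLp (μ[f | m]) 2 μ := hf.condExp (by norm_num)
  have hpyth := integral_sq_sub_eq_add hm hf hk
    (stronglyMeasurable_condExp.mono hkm).aestronglyMeasurable
  have hnn : 0 ≤ ∫ x, ((μ[f | m]) x - (μ[f | k]) x) ^ 2 ∂μ := integral_nonneg fun x => sq_nonneg _
  have hz : ∫ x, ((μ[f | m]) x - (μ[f | k]) x) ^ 2 ∂μ = 0 := by linarith
  have hi : Integrable (fun x => ((μ[f | m]) x - (μ[f | k]) x) ^ 2) μ := (hc.sub hk).integrable_sq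
  rw [integral_eq_zero_iff_of_nonneg (fun x => sq_nonneg _) hi] at hz
  filter_upwards [hz] with x hx
  exact sub_eq_zero.mp (pow_eq_zero_iff two_ne_zero |>.mp hx)

lemma tendsto_integral_sq_sub_condExp [IsFiniteMeasure μ] (ℱ : Filtration ℕ m0)
    {s : Set Ω} (hs : MeasurableSet s) :
    Tendsto (fun n => ∫ x, ((s.indicator fun _ => (1 : ℝ)) x
        - (μ[s.indicator fun _ => (1 : ℝ) | ℱ n]) x) ^ 2 ∂μ) atTop
      (𝓝 (∫ x, ((s.indicator fun _ => (1 : ℝ)) x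
        - (μ[s.indicator fun _ => (1 : ℝ) | ⨆ n, ℱ n]) x) ^ 2 ∂μ)) := by
  have hf := memLp_two_indicator_one (μ := μ) hs
  have hbd : ∀ x, |(s.indicator fun _ => (1 : ℝ)) x| ≤ 1 := fun x => by
    by_cases hx : x ∈ s <;> simp [hx]
  refine tendsto_integral_of_dominated_convergence (fun _ => 4) (fun n => ?_)
    (integrable_const _) (fun n => ?_) ?_
  · exact ((hf.sub (hf.condExp (by norm_num))).integrable_sq).aestronglyMeasurable
  · have := ae_bdd_abs_condExp_of_ae_bdd_abs (m := ℱ n) (μ := μ) (R := 1)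
      (f := s.indicator fun _ => (1 : ℝ)) (Eventually.of_forall hbd)
    filter_upwards [this] with x hx
    have h1 := abs_le.mp (hbd x)
    have h2 := abs_le.mp hx
    rw [Real.norm_eq_abs, abs_of_nonneg (sq_nonneg _)]
    nlinarith
  · filter_upwards [tendsto_ae_condExp (μ := μ) (ℱ := ℱ) (s.indicator fun _ => (1 : ℝ))] with x hx
    exact (tendsto_const_nhds.sub hx).pow 2

lemma sup_eq_generateFrom_image2_inter (m₁ m₂ : MeasurableSpace Ω) :
    m₁ ⊔ m₂ = MeasurableSpace.generateFrom
      (Set.image2 (· ∩ ·) {s | MeasurableSet[m₁] s} {s | MeasurableSet[m₂] s}) := by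
  refine le_antisymm (sup_le (fun s hs => ?_) fun s hs => ?_) (MeasurableSpace.generateFrom_le ?_)
  · exact MeasurableSpace.measurableSet_generateFrom
      ⟨s, hs, Set.univ, MeasurableSet.univ, Set.inter_univ s⟩
  · exact MeasurableSpace.measurableSet_generateFrom
      ⟨Set.univ, MeasurableSet.univ, s, hs, Set.univ_inter s⟩
  · rintro _ ⟨s, hs, w, hw, rfl⟩
    exact MeasurableSet.inter (le_sup_left (a := m₁) (b := m₂) s hs)
      (le_sup_right (a := m₁) (b := m₂) w hw)

lemma isPiSystem_image2_inter (m₁ m₂ : MeasurableSpace Ω) :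
    IsPiSystem (Set.image2 (· ∩ ·) {s | MeasurableSet[m₁] s} {s | MeasurableSet[m₂] s}) := by
  rintro _ ⟨s₁, hs₁, w₁, hw₁, rfl⟩ _ ⟨s₂, hs₂, w₂, hw₂, rfl⟩ -
  exact ⟨s₁ ∩ s₂, MeasurableSet.inter hs₁ hs₂, w₁ ∩ w₂, MeasurableSet.inter hw₁ hw₂,
    Set.inter_inter_inter_comm s₁ s₂ w₁ w₂⟩

/-- If conditioning events of `m₁` on `m₂` depends only on `k ≤ m₂`, then conditioning events of
`m₂` on `m₁ ⊔ k` depends only on `k`. -/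
lemma condExp_sup_ae_eq_of_condExp_ae_eq [IsFiniteMeasure μ] {m₁ m₂ k : MeasurableSpace Ω}
    (hm₁ : m₁ ≤ m0) (hm₂ : m₂ ≤ m0) (hk : k ≤ m₂)
    (h : ∀ s, MeasurableSet[m₁] s →
      μ[s.indicator fun _ => (1 : ℝ) | m₂] =ᵐ[μ] μ[s.indicator fun _ => (1 : ℝ) | k])
    {t : Set Ω} (ht : MeasurableSet[m₂] t) :
    μ[t.indicator fun _ => (1 : ℝ) | m₁ ⊔ k] =ᵐ[μ] μ[t.indicator fun _ => (1 : ℝ) | k] := by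
  have hk0 : k ≤ m0 := hk.trans hm₂
  have hsup : m₁ ⊔ k ≤ m0 := sup_le hm₁ hk0
  have hft := memLp_two_indicator_one (μ := μ) (hm₂ t ht)
  have hft1 : Integrable (t.indicator fun _ => (1 : ℝ)) μ := hft.integrable (by norm_num)
  refine (ae_eq_condExp_of_forall_setIntegral_eq hsup hft1
    (fun u _ _ => integrable_condExp.integrableOn) (fun u hu _ => ?_)
    (stronglyMeasurable_condExp.mono (le_sup_right (a := m₁))).aestronglyMeasurable).symm
  have hct : MemLp (μ[t.indicator fun _ => (1 : ℝ) | k]) 2 μ := hft.condExp (by norm_num)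
  induction u, hu using MeasurableSpace.induction_on_inter
    (sup_eq_generateFrom_image2_inter m₁ k) (isPiSystem_image2_inter m₁ k) with
  | empty => simp
  | basic u hu =>
    obtain ⟨s, hs, w, hw, rfl⟩ := hu
    have hs0 := hm₁ s hs
    have hfs := memLp_two_indicator_one (μ := μ) hs0
    have hfs1 : Integrable (s.indicator fun _ => (1 : ℝ)) μ := hfs.integrable (by norm_num)
    have hcs : MemLp (μ[s.indicator fun _ => (1 : ℝ) | k]) 2 μ := hfs.condExp (by norm_num)
    have e1 := condExp_mul_of_stronglyMeasurable_right (μ := μ)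
      (stronglyMeasurable_condExp (m := k) (f := t.indicator fun _ => (1 : ℝ)) (μ := μ))
      (hfs.integrable_mul hct) hfs1
    have e2 := condExp_mul_of_stronglyMeasurable_right (μ := μ)
      (stronglyMeasurable_condExp (m := k) (f := s.indicator fun _ => (1 : ℝ)) (μ := μ))
      (hft.integrable_mul hcs) hft1
    have i1 : ∫ x in w ∩ s, (μ[t.indicator fun _ => (1 : ℝ) | k]) x ∂μ
        = ∫ x in w, ((μ[s.indicator fun _ => (1 : ℝ) | k])
            * (μ[t.indicator fun _ => (1 : ℝ) | k])) x ∂μ := by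
      rw [← setIntegral_indicator_one_mul hs0,
        ← setIntegral_condExp hk0 (hfs.integrable_mul hct) hw]
      exact integral_congr_ae (ae_restrict_of_ae e1)
    have i2 : ∫ x in w ∩ t, (μ[s.indicator fun _ => (1 : ℝ) | k]) x ∂μ
        = ∫ x in w, ((μ[t.indicator fun _ => (1 : ℝ) | k])
            * (μ[s.indicator fun _ => (1 : ℝ) | k])) x ∂μ := by
      rw [← setIntegral_indicator_one_mul (hm₂ t ht),
        ← setIntegral_condExp hk0 (hft.integrable_mul hcs) hw]
      exact integral_congr_ae (ae_restrict_of_ae e2)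
    have i3 : ∫ x in w ∩ t, (μ[s.indicator fun _ => (1 : ℝ) | k]) x ∂μ
        = ∫ x in w ∩ t, (s.indicator fun _ => (1 : ℝ)) x ∂μ := by
      rw [← setIntegral_condExp hm₂ hfs1 ((hk w hw).inter ht)]
      exact integral_congr_ae (ae_restrict_of_ae (h s hs).symm)
    change ∫ x in s ∩ w, _ ∂μ = ∫ x in s ∩ w, _ ∂μ
    rw [Set.inter_comm s w, i1, mul_comm, ← i2, i3, setIntegral_indicator hs0,
      setIntegral_indicator (hm₂ t ht), Set.inter_right_comm]
  | compl u hu ih =>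
    have h1 := integral_add_compl (hsup u hu) (integrable_condExp (m := k)
      (f := t.indicator fun _ => (1 : ℝ)) (μ := μ))
    have h2 := integral_add_compl (hsup u hu) hft1
    have h3 := integral_condExp (μ := μ) (f := t.indicator fun _ => (1 : ℝ)) hk0
    have h4 := ih (measure_lt_top μ u)
    linarith
  | iUnion u hd hu ih =>
    rw [integral_iUnion (fun i => hsup _ (hu i)) hd integrable_condExp.integrableOn,
      integral_iUnion (fun i => hsup _ (hu i)) hd hft1.integrableOn]
    exact tsum_congr fun i => ih i (measure_lt_top μ _)

/-- Let `G` be a decreasing sequence of σ-fields with intersection `τ`. If each event `t` of `m₂`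
satisfies `μ⟦t | m₁ ⊔ G n⟧ = μ⟦t | G n⟧` for all `n`, then `m₁` and `m₂` are conditionally
independent given `τ`. -/
lemma condIndep_iInf_of_condExp_sup_ae_eq [StandardBorelSpace Ω] [IsFiniteMeasure μ]
    {m₁ m₂ τ : MeasurableSpace Ω} {G : ℕ → MeasurableSpace Ω} (hm₁ : m₁ ≤ m0) (hm₂ : m₂ ≤ m0)
    (hG : Antitone G) (hle : ∀ n, G n ≤ m0) (hτ : τ = ⨅ n, G n) (hτ0 : τ ≤ m0)
    (h : ∀ n t, MeasurableSet[m₂] t →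
      μ[t.indicator fun _ => (1 : ℝ) | m₁ ⊔ G n] =ᵐ[μ] μ[t.indicator fun _ => (1 : ℝ) | G n]) :
    CondIndep τ m₁ m₂ hτ0 μ := by
  refine (condIndep_iff τ m₁ m₂ hτ0 hm₁ hm₂ μ).mpr fun s t hs ht => ?_
  have hs0 := hm₁ s hs
  have ht0 := hm₂ t ht
  have hfs := memLp_two_indicator_one (μ := μ) hs0
  have hft := memLp_two_indicator_one (μ := μ) ht0
  have hfs1 : Integrable (s.indicator fun _ => (1 : ℝ)) μ := hfs.integrable (by norm_num)
  have hft1 : Integrable (t.indicator fun _ => (1 : ℝ)) μ := hft.integrable (by norm_num)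
  have hfst : Integrable ((s ∩ t).indicator fun _ => (1 : ℝ)) μ :=
    (memLp_two_indicator_one (hs0.inter ht0)).integrable (by norm_num)
  have hct : MemLp (μ[t.indicator fun _ => (1 : ℝ) | τ]) 2 μ := hft.condExp (by norm_num)
  have key : ∀ w, MeasurableSet[τ] w → ∫ x in w ∩ s, (μ[t.indicator fun _ => (1 : ℝ) | τ]) x ∂μ
      = ∫ x in w ∩ s, (t.indicator fun _ => (1 : ℝ)) x ∂μ := fun w hw => by
    have hlim := tendsto_setIntegral_condExp_iInf hG hle hft ((hτ0 w hw).inter hs0)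
    rw [← hτ] at hlim
    refine tendsto_nhds_unique hlim (tendsto_const_nhds.congr fun n => ?_)
    have hw' : MeasurableSet[m₁ ⊔ G n] (w ∩ s) :=
      MeasurableSet.inter ((hτ.le.trans (iInf_le G n)).trans le_sup_right w hw)
        (le_sup_left (a := m₁) (b := G n) s hs)
    rw [← setIntegral_condExp (sup_le hm₁ (hle n)) hft1 hw']
    exact integral_congr_ae (ae_restrict_of_ae (h n t ht))
  have hpull := condExp_mul_of_stronglyMeasurable_right (μ := μ)
    (stronglyMeasurable_condExp (m := τ) (f := t.indicator fun _ => (1 : ℝ)) (μ := μ))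
    (hfs.integrable_mul hct) hfs1
  refine (ae_eq_condExp_of_forall_setIntegral_eq hτ0 hfst
    (fun w _ _ => integrable_condExp.integrableOn) (fun w hw _ => ?_)
    stronglyMeasurable_condExp.aestronglyMeasurable).symm.trans hpull
  rw [setIntegral_condExp hτ0 (hfs.integrable_mul hct) hw, setIntegral_indicator_one_mul hs0,
    key w hw, setIntegral_indicator ht0, setIntegral_indicator (hs0.inter ht0), Set.inter_assoc]

end CondExp

section Coordinates

variable {M : Type*}

/-- The σ-field generated by the coordinate projections `ξ_a` with `a ∈ B`. -/
def coordFieldOn (B : Set M) : MeasurableSpace (M → unitInterval) :=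
  ⨆ a ∈ B, coordField a

lemma coordFieldOn_le (B : Set M) :
    coordFieldOn B ≤ (inferInstance : MeasurableSpace (M → unitInterval)) :=
  iSup₂_le fun a _ => measurable_iff_comap_le.mp (measurable_pi_apply a)

lemma coordFieldOn_mono {B C : Set M} (h : B ⊆ C) : coordFieldOn B ≤ coordFieldOn C :=
  biSup_mono h

lemma coordFieldOn_union (B C : Set M) :
    coordFieldOn (B ∪ C) = coordFieldOn B ⊔ coordFieldOn C :=
  iSup_union

lemma measurable_shiftAct (g : Equiv.Perm M) : Measurable (shiftAct g) :=
  measurable_pi_iff.mpr fun a => measurable_pi_apply (g⁻¹ a)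

lemma measurable_shiftAct_coordFieldOn {g : Equiv.Perm M} {B C : Set M}
    (h : ∀ b ∈ B, g⁻¹ b ∈ C) :
    @Measurable _ _ (coordFieldOn C) (coordFieldOn B) (shiftAct g) := by
  rw [measurable_iff_comap_le, coordFieldOn, MeasurableSpace.comap_iSup]
  refine iSup_le fun b => ?_
  rw [MeasurableSpace.comap_iSup]
  refine iSup_le fun hb => ?_
  rw [coordField, MeasurableSpace.comap_comp]
  exact le_iSup₂_of_le (g⁻¹ b) (h b hb) le_rfl

lemma shiftAct_preimage_eq_of_fixes {g : Equiv.Perm M} {A : Set M} (hg : ∀ a ∈ A, g⁻¹ a = a)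
    {s : Set (M → unitInterval)} (hs : MeasurableSet[coordFieldOn A] s) :
    shiftAct g ⁻¹' s = s := by
  have hle : coordFieldOn A ≤ MeasurableSpace.invariants (shiftAct g) := by
    refine iSup₂_le fun a ha => ?_
    rintro _ ⟨v, hv, rfl⟩
    refine MeasurableSpace.measurableSet_invariants.mpr ⟨measurable_pi_apply a hv, ?_⟩
    ext ω
    simp [shiftAct, hg a ha]
  exact (MeasurableSpace.measurableSet_invariants.mp (hle s hs)).2

lemma tailField_eq_iInf_of_exhausting {S : ℕ → Finset M} (hS : ∀ B : Finset M, ∃ n, B ⊆ S n) :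
    tailField M = ⨅ n, coordFieldOn (S n : Set M)ᶜ := by
  refine le_antisymm (le_iInf fun n => iInf_le _ (S n)) (le_iInf fun B => ?_)
  obtain ⟨n, hn⟩ := hS B
  exact (iInf_le _ n).trans (coordFieldOn_mono fun a ha haB => ha (hn haB))

lemma exists_monotone_exhausting_finset (M : Type*) [Countable M] :
    ∃ S : ℕ → Finset M, Monotone S ∧ ∀ B : Finset M, ∃ n, B ⊆ S n := by
  obtain ⟨e, he⟩ := exists_injective_nat M
  refine ⟨fun n => (Finset.range n).preimage e he.injOn, fun i j hij a ha => ?_, fun B => ?_⟩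
  · simp only [Finset.mem_preimage, Finset.mem_range] at ha ⊢
    exact ha.trans_le hij
  · refine ⟨B.sup e + 1, fun b hb => ?_⟩
    simp only [Finset.mem_preimage, Finset.mem_range]
    exact Nat.lt_succ_of_le (Finset.le_sup hb)

/-- Removing finitely many coordinates outside `A` does not affect the conditional expectation of
events inside `A`. -/
lemma condExp_coordFieldOn_compl_ae_eq [Countable M] (G : Subgroup (Equiv.Perm M)) (A : Set M)
    (horb : ∀ b : M, b ∉ A → {c : M | ∃ g ∈ G, (∀ a ∈ A, g a = a) ∧ g b = c}.Infinite)
    (μ : Measure (M → unitInterval)) [IsProbabilityMeasure μ]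
    (hinv : ∀ g ∈ G, μ.map (shiftAct g) = μ) (S : Finset M)
    {s : Set (M → unitInterval)} (hs : MeasurableSet[coordFieldOn A] s) :
    μ[s.indicator fun _ => (1 : ℝ) | coordFieldOn Aᶜ]
      =ᵐ[μ] μ[s.indicator fun _ => (1 : ℝ) | coordFieldOn (Aᶜ \ S)] := by
  classical
  obtain ⟨T, hTmono, hT⟩ := exists_monotone_exhausting_finset M
  have hs0 := coordFieldOn_le A s hs
  have hf := memLp_two_indicator_one (μ := μ) hs0
  let ℱ : Filtration ℕ (inferInstance : MeasurableSpace (M → unitInterval)) :=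
    { seq := fun n => coordFieldOn (Aᶜ ∩ T n)
      mono' := fun i j hij => coordFieldOn_mono
        (Set.inter_subset_inter_right _ (Finset.coe_subset.mpr (hTmono hij)))
      le' := fun n => coordFieldOn_le _ }
  have hℱ : ⨆ n, ℱ n = coordFieldOn Aᶜ := by
    refine le_antisymm (iSup_le fun n => coordFieldOn_mono Set.inter_subset_left)
      (iSup₂_le fun a ha => ?_)
    obtain ⟨n, hn⟩ := hT {a}
    exact le_iSup_of_le n (le_iSup₂_of_le (f := fun b (_ : b ∈ Aᶜ ∩ (T n : Set M)) => coordField b)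
      a ⟨ha, hn (Finset.mem_singleton_self a)⟩ le_rfl)
  have hlim := tendsto_integral_sq_sub_condExp (μ := μ) ℱ hs0
  rw [hℱ] at hlim
  refine condExp_ae_eq_of_integral_sq_sub_le (coordFieldOn_le _)
    (coordFieldOn_mono Set.sdiff_subset) hf (ge_of_tendsto' hlim fun n => ?_)
  obtain ⟨g, hgG, hgA, hgS⟩ := exists_mem_stabilizer_disjoint G A horb {a ∈ T n | a ∉ A} S
    fun b hb => (Finset.mem_filter.mp hb).2
  have hpres : μ.map (shiftAct g⁻¹) = μ := hinv _ (G.inv_mem hgG)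
  have hmp : MeasurePreserving (shiftAct g⁻¹) μ μ := ⟨measurable_shiftAct _, hpres⟩
  have hc : MemLp (μ[s.indicator fun _ => (1 : ℝ) | ℱ n]) 2 μ := hf.condExp (by norm_num)
  have hshift : ∀ b ∈ Aᶜ ∩ (T n : Set M), (g⁻¹)⁻¹ b ∈ Aᶜ \ (S : Set M) := fun b hb => by
    rw [inv_inv]
    refine ⟨fun hgb => hb.1 ?_, hgS b (Finset.mem_filter.mpr ⟨hb.2, hb.1⟩)⟩
    have := g.injective (hgA _ hgb)
    rwa [this] at hgb
  have hind : ∀ ω, (s.indicator fun _ => (1 : ℝ)) (shiftAct g⁻¹ ω)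
      = (s.indicator fun _ => (1 : ℝ)) ω := fun ω => by
    have hpre := shiftAct_preimage_eq_of_fixes (g := g⁻¹) (by simpa using hgA) hs
    have hmem : shiftAct g⁻¹ ω ∈ s ↔ ω ∈ s := Set.ext_iff.mp hpre ω
    by_cases hω : ω ∈ s <;> simp [hmem, hω]
  have hcomp : ∫ ω, ((s.indicator fun _ => (1 : ℝ)) ω
        - (μ[s.indicator fun _ => (1 : ℝ) | ℱ n]) (shiftAct g⁻¹ ω)) ^ 2 ∂μ
      = ∫ ω, ((s.indicator fun _ => (1 : ℝ)) ω
        - (μ[s.indicator fun _ => (1 : ℝ) | ℱ n]) ω) ^ 2 ∂μ := by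
    have hmap := integral_map (μ := μ) (measurable_shiftAct g⁻¹).aemeasurable
      (f := fun ω => ((s.indicator fun _ => (1 : ℝ)) ω
        - (μ[s.indicator fun _ => (1 : ℝ) | ℱ n]) ω) ^ 2)
      (by rw [hpres]; exact (hf.sub hc).integrable_sq.aestronglyMeasurable)
    rw [hpres] at hmap
    simp_rw [hmap, hind]
  rw [← hcomp]
  exact integral_sq_sub_condExp_le (coordFieldOn_le _) hf (hc.comp_measurePreserving hmp)
    (stronglyMeasurable_condExp.comp_measurable
      (measurable_shiftAct_coordFieldOn hshift)).aestronglyMeasurable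

end Coordinates

/-- if every orbit of the pointwise stabilizer `G_{(A)}` on `M ∖ A` is
infinite, then for any `G`-invariant probability measure on `[0,1]^M`, the σ-fields
`σ(ξ_a : a ∈ A)` and `σ(ξ_a : a ∈ M ∖ A)` are conditionally independent given the tail
σ-field `T₀`. -/
theorem condIndep_inside_outside_given_tail
    {M : Type*} [Countable M] (G : Subgroup (Equiv.Perm M)) (A : Set M)
    (horb : ∀ b : M, b ∉ A → {c : M | ∃ g ∈ G, (∀ a ∈ A, g a = a) ∧ g b = c}.Infinite)
    (μ : Measure (M → unitInterval)) [IsProbabilityMeasure μ]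
    (hinv : ∀ g ∈ G, μ.map (shiftAct g) = μ) :
    CondIndep (tailField M)
      (⨆ a ∈ A, coordField a) (⨆ (a : M) (_ : a ∉ A), coordField a)
      (tailField_le M) μ := by
  obtain ⟨S, hSmono, hS⟩ := exists_monotone_exhausting_finset M
  refine condIndep_iInf_of_condExp_sup_ae_eq (m₁ := coordFieldOn A) (m₂ := coordFieldOn Aᶜ)
    (G := fun n => coordFieldOn (S n : Set M)ᶜ) (coordFieldOn_le A) (coordFieldOn_le Aᶜ)
    (fun i j hij => coordFieldOn_mono
      (Set.compl_subset_compl.mpr (Finset.coe_subset.mpr (hSmono hij))))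
    (fun n => coordFieldOn_le _) (tailField_eq_iInf_of_exhausting hS) (tailField_le M)
    fun n t ht => ?_
  have hKG : coordFieldOn (Aᶜ \ S n) ≤ coordFieldOn (S n : Set M)ᶜ :=
    coordFieldOn_mono fun a ha => ha.2
  have hsup : coordFieldOn A ⊔ coordFieldOn (S n : Set M)ᶜ
      = coordFieldOn A ⊔ coordFieldOn (Aᶜ \ S n) := by
    rw [← coordFieldOn_union, ← coordFieldOn_union]
    congr 1
    ext a
    simp only [Set.mem_union, Set.mem_compl_iff, Set.mem_sdiff]
    tauto
  have hK := condExp_sup_ae_eq_of_condExp_ae_eq (coordFieldOn_le A) (coordFieldOn_le Aᶜ)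
    (coordFieldOn_mono Set.sdiff_subset)
    (fun s hs => condExp_coordFieldOn_compl_ae_eq G A horb μ hinv (S n) hs) ht
  rw [← hsup] at hK
  have htower := condExp_condExp_of_le (μ := μ) (f := t.indicator fun _ => (1 : ℝ))
    (le_sup_right : coordFieldOn (S n : Set M)ᶜ ≤ coordFieldOn A ⊔ coordFieldOn (S n : Set M)ᶜ)
    (sup_le (coordFieldOn_le A) (coordFieldOn_le _))
  have hself := condExp_of_stronglyMeasurable (μ := μ) (coordFieldOn_le (S n : Set M)ᶜ)
    (stronglyMeasurable_condExp.mono hKG) (integrable_condExp (m := coordFieldOn (Aᶜ \ S n))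
      (f := t.indicator fun _ => (1 : ℝ)))
  have hstep := condExp_congr_ae (m := coordFieldOn (S n : Set M)ᶜ) hK
  rw [hself] at hstep
  exact hK.trans (hstep.symm.trans htower)
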